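/- arXiv:1402.3319 — 15 statements merged into one kernel-verified Lean document; each statement's English description precedes it below -/
import Mathlib

section
/- Fix a constant c > 0 and let F(p,n) = (p, n, c)/(p+n+c) denote the evidence-to-opinion map. Then for all nonnegative reals p₁, n₁, p₂, n₂, the opinion formed from the combined evidence equals the consensus of the individual opinions: F(p₁+p₂, n₁+n₂) = F(p₁,n₁) ⊕ F(p₂,n₂). -/
noncomputable section

/-- The opinion space excluding dogmatic opinions. -/
def Omega' : Set (ℝ × ℝ × ℝ) :=
  {x | x.1 ∈ Set.Ico (0:ℝ) 1 ∧ x.2.1 ∈ Set.Ico (0:ℝ) 1 ∧ x.2.2 ∈ Set.Ioc (0:ℝ) 1 ∧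
    x.1 + x.2.1 + x.2.2 = 1}

/-- The full uncertainty opinion U = (0,0,1). -/
def Uop : ℝ × ℝ × ℝ := (0, 0, 1)

/-- The consensus operation ⊕. -/
def consensus (x y : ℝ × ℝ × ℝ) : ℝ × ℝ × ℝ :=
  ((x.2.2 * y.1 + y.2.2 * x.1) / (x.2.2 + y.2.2 - x.2.2 * y.2.2),
   (x.2.2 * y.2.1 + y.2.2 * x.2.1) / (x.2.2 + y.2.2 - x.2.2 * y.2.2),
   x.2.2 * y.2.2 / (x.2.2 + y.2.2 - x.2.2 * y.2.2))

/-- Scalar multiplication α·x of evidence. -/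
def smulOp (α : ℝ) (x : ℝ × ℝ × ℝ) : ℝ × ℝ × ℝ :=
  (α * x.1 / (α * (x.1 + x.2.1) + x.2.2),
   α * x.2.1 / (α * (x.1 + x.2.1) + x.2.2),
   x.2.2 / (α * (x.1 + x.2.1) + x.2.2))

/-- Positive evidence p(x) = c·x_b/x_u. -/
def pEv (c : ℝ) (x : ℝ × ℝ × ℝ) : ℝ := c * x.1 / x.2.2

/-- Negative evidence n(x) = c·x_d/x_u. -/
def nEv (c : ℝ) (x : ℝ × ℝ × ℝ) : ℝ := c * x.2.1 / x.2.2

/-- The new discounting rule x ⊠ y = g(x)·y. -/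
def box (g : ℝ × ℝ × ℝ → ℝ) (x y : ℝ × ℝ × ℝ) : ℝ × ℝ × ℝ := smulOp (g x) y

/-- Subjective Logic discounting x ⊗ y. -/
def otimesSL (x y : ℝ × ℝ × ℝ) : ℝ × ℝ × ℝ :=
  (x.1 * y.1, x.1 * y.2.1, x.2.1 + x.2.2 + x.1 * y.2.2)

/-- The evidence-to-opinion map F(p,n) = (p,n,c)/(p+n+c). -/
def Fmap (c : ℝ) (pn : ℝ × ℝ) : ℝ × ℝ × ℝ :=
  (pn.1 / (pn.1 + pn.2 + c), pn.2 / (pn.1 + pn.2 + c), c / (pn.1 + pn.2 + c))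

theorem stmt1 (c : ℝ) (hc : 0 < c) (p1 n1 p2 n2 : ℝ)
    (hp1 : 0 ≤ p1) (hn1 : 0 ≤ n1) (hp2 : 0 ≤ p2) (hn2 : 0 ≤ n2) :
    Fmap c (p1 + p2, n1 + n2) = consensus (Fmap c (p1, n1)) (Fmap c (p2, n2)) := by
  have h1 : p1 + n1 + c ≠ 0 := by positivity
  have h2 : p2 + n2 + c ≠ 0 := by positivity
  have h : p1 + p2 + (n1 + n2) + c ≠ 0 := by positivity
  have hd : c / (p1 + n1 + c) + c / (p2 + n2 + c) - c / (p1 + n1 + c) * (c / (p2 + n2 + c)) =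
      c * (p1 + p2 + (n1 + n2) + c) / ((p1 + n1 + c) * (p2 + n2 + c)) := by
    field_simp
    ring
  simp only [Fmap, consensus, hd, Prod.mk.injEq]
  refine ⟨?_, ?_, ?_⟩ <;> field_simp <;> ring
end
end

section
/- The consensus operation is an internal, commutative and associative operation on Ω' with identity element U: for all x, y, z ∈ Ω', x ⊕ y ∈ Ω', x ⊕ y = y ⊕ x, (x ⊕ y) ⊕ z = x ⊕ (y ⊕ z), and U ⊕ x = x. -/
noncomputable section

theorem consensus_denom_pos {u v : ℝ} (hu : u ∈ Set.Ioc (0 : ℝ) 1) (hv : v ∈ Set.Ioc (0 : ℝ) 1) :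
    0 < u + v - u * v := by
  nlinarith [hu.1, hv.1, mul_nonneg hu.1.le (sub_nonneg.2 hv.2)]

theorem consensus_comm (x y : ℝ × ℝ × ℝ) : consensus x y = consensus y x := by
  simp only [consensus, Prod.mk.injEq]
  refine ⟨?_, ?_, ?_⟩ <;> congr 1 <;> ring

theorem consensus_mem {x y : ℝ × ℝ × ℝ} (hx : x ∈ Omega') (hy : y ∈ Omega') :
    consensus x y ∈ Omega' := by
  obtain ⟨b, d, u⟩ := x
  obtain ⟨b', d', u'⟩ := y
  obtain ⟨⟨hb, -⟩, ⟨hd, -⟩, hu, hs⟩ := hx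
  obtain ⟨⟨hb', -⟩, ⟨hd', -⟩, hu', hs'⟩ := hy
  dsimp only at hb hd hu hs hb' hd' hu' hs'
  have hD := consensus_denom_pos hu hu'
  have hu0 := hu.1
  have hu0' := hu'.1
  have h1 : 0 ≤ (u * b' + u' * b) / (u + u' - u * u') := by positivity
  have h2 : 0 ≤ (u * d' + u' * d) / (u + u' - u * u') := by positivity
  have h3 : 0 < u * u' / (u + u' - u * u') := by positivity
  have h4 : (u * b' + u' * b) / (u + u' - u * u') + (u * d' + u' * d) / (u + u' - u * u') +
      u * u' / (u + u' - u * u') = 1 := by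
    rw [← add_div, ← add_div, div_eq_one_iff_eq hD.ne']
    linear_combination u * hs' + u' * hs
  exact ⟨⟨h1, by dsimp only [consensus]; linarith⟩, ⟨h2, by dsimp only [consensus]; linarith⟩,
    ⟨h3, by dsimp only [consensus]; linarith⟩, h4⟩

/-- Iterated consensus over a common denominator. -/
theorem consensus_consensus_eq {x y : ℝ × ℝ × ℝ} (z : ℝ × ℝ × ℝ)
    (h : x.2.2 + y.2.2 - x.2.2 * y.2.2 ≠ 0) :
    consensus (consensus x y) z =
      ((x.2.2 * y.2.2 * z.1 + z.2.2 * (x.2.2 * y.1 + y.2.2 * x.1)) /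
        (x.2.2 * y.2.2 + y.2.2 * z.2.2 + z.2.2 * x.2.2 - 2 * (x.2.2 * y.2.2 * z.2.2)),
       (x.2.2 * y.2.2 * z.2.1 + z.2.2 * (x.2.2 * y.2.1 + y.2.2 * x.2.1)) /
        (x.2.2 * y.2.2 + y.2.2 * z.2.2 + z.2.2 * x.2.2 - 2 * (x.2.2 * y.2.2 * z.2.2)),
       x.2.2 * y.2.2 * z.2.2 /
        (x.2.2 * y.2.2 + y.2.2 * z.2.2 + z.2.2 * x.2.2 - 2 * (x.2.2 * y.2.2 * z.2.2))) := by
  simp only [consensus, Prod.mk.injEq]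
  refine ⟨?_, ?_, ?_⟩ <;> symm <;> rw [← div_div_div_cancel_right₀ h] <;> congr 1 <;>
    field_simp <;> ring

theorem stmt2 :
    (∀ x ∈ Omega', ∀ y ∈ Omega', consensus x y ∈ Omega') ∧
    (∀ x ∈ Omega', ∀ y ∈ Omega', consensus x y = consensus y x) ∧
    (∀ x ∈ Omega', ∀ y ∈ Omega', ∀ z ∈ Omega',
      consensus (consensus x y) z = consensus x (consensus y z)) ∧
    (∀ x ∈ Omega', consensus Uop x = x) := by
  refine ⟨fun x hx y hy => consensus_mem hx hy, fun x _ y _ => consensus_comm x y,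
    fun x hx y hy z hz => ?_, fun x _ => ?_⟩
  · rw [consensus_comm x (consensus y z), consensus_consensus_eq z (consensus_denom_pos hx.2.2.1 hy.2.2.1).ne',
      consensus_consensus_eq x (consensus_denom_pos hy.2.2.1 hz.2.2.1).ne']
    simp only [Prod.mk.injEq]
    refine ⟨?_, ?_, ?_⟩ <;> congr 1 <;> ring
  · simp [consensus, Uop]
end
end

section
/- Let x ∈ Ω' and α ≥ 0 a real scalar. Then: (1) α·x ∈ Ω'; (2) 0·x = U; (3) 1·x = x; (4) the evidence underlying α·x is α times the evidence underlying x, i.e. p(α·x) = α·p(x) and n(α·x) = α·n(x); (5) if α ≠ 0 then the belief-to-disbelief ratio is preserved, i.e. (α·x)_b · x_d = (α·x)_d · x_b. -/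
noncomputable section

theorem stmt3 (c : ℝ) (hc : 0 < c) (x : ℝ × ℝ × ℝ) (hx : x ∈ Omega')
    (α : ℝ) (hα : 0 ≤ α) :
    smulOp α x ∈ Omega' ∧
    smulOp 0 x = Uop ∧
    smulOp 1 x = x ∧
    pEv c (smulOp α x) = α * pEv c x ∧
    nEv c (smulOp α x) = α * nEv c x ∧
    (α ≠ 0 → (smulOp α x).1 * x.2.1 = (smulOp α x).2.1 * x.1) := by
  obtain ⟨b, d, u⟩ := x
  obtain ⟨⟨hb, -⟩, ⟨hd, -⟩, ⟨hu, -⟩, hsum⟩ := hx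
  dsimp only at hb hd hu hsum
  have hαb : 0 ≤ α * b := mul_nonneg hα hb
  have hαd : 0 ≤ α * d := mul_nonneg hα hd
  have hD : 0 < α * (b + d) + u := by linarith [mul_add α b d]
  refine ⟨⟨⟨?_, ?_⟩, ⟨?_, ?_⟩, ⟨?_, ?_⟩, ?_⟩, ?_, ?_, ?_, ?_, fun _ => ?_⟩
  · exact div_nonneg hαb hD.le
  · exact (div_lt_one hD).2 (by dsimp only; linarith [mul_add α b d])
  · exact div_nonneg hαd hD.le
  · exact (div_lt_one hD).2 (by dsimp only; linarith [mul_add α b d])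
  · exact div_pos hu hD
  · exact (div_le_one hD).2 (by dsimp only; linarith [mul_add α b d])
  · simp only [smulOp]
    rw [← add_div, ← add_div, ← mul_add, div_self hD.ne']
  · simp [smulOp, Uop, hu.ne']
  · simp [smulOp, hsum]
  · simp only [smulOp, pEv]
    field_simp
  · simp only [smulOp, nEv]
    field_simp
  · simp only [smulOp]
    ring
end
end

section
/- Let x ∈ Ω' and let m ∈ ℕ with m ≥ 2. Then the scalar multiple m·x equals the m-fold consensus of x with itself: m·x = x ⊕ x ⊕ ⋯ ⊕ x (m terms). -/
noncomputable section

/-- `nfold x k` is the consensus of `k+1` copies of `x`. -/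
def nfold (x : ℝ × ℝ × ℝ) : ℕ → ℝ × ℝ × ℝ
  | 0 => x
  | k + 1 => consensus x (nfold x k)

theorem consensus_smulOp {x : ℝ × ℝ × ℝ} (hx : x ∈ Omega') {α : ℝ} (hα : 0 ≤ α) :
    consensus x (smulOp α x) = smulOp (α + 1) x := by
  obtain ⟨b, d, u⟩ := x
  obtain ⟨⟨hb, -⟩, ⟨hd, -⟩, ⟨hu, -⟩, hsum⟩ := hx
  dsimp only at hb hd hu hsum
  have hD : 0 < α * (b + d) + u := by positivity
  have hD' : 0 < (α + 1) * (b + d) + u := by positivity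
  have hden : u + u / (α * (b + d) + u) - u * (u / (α * (b + d) + u)) =
      u * ((α + 1) * (b + d) + u) / (α * (b + d) + u) := by
    field_simp
    linear_combination -hsum
  simp only [consensus, smulOp, hden, Prod.mk.injEq]
  refine ⟨?_, ?_, ?_⟩ <;> field_simp

theorem smulOp_one {x : ℝ × ℝ × ℝ} (hx : x ∈ Omega') : smulOp 1 x = x := by
  simp [smulOp, hx.2.2.2]

theorem nfold_eq_smulOp {x : ℝ × ℝ × ℝ} (hx : x ∈ Omega') (k : ℕ) :
    nfold x k = smulOp ((k : ℝ) + 1) x := by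
  induction k with
  | zero => simp [nfold, smulOp_one hx]
  | succ k ih =>
    rw [nfold, ih, consensus_smulOp hx (by positivity)]
    push_cast
    rfl

theorem stmt4 (x : ℝ × ℝ × ℝ) (hx : x ∈ Omega') (m : ℕ) (hm : 2 ≤ m) :
    smulOp (m : ℝ) x = nfold x (m - 1) := by
  obtain ⟨k, rfl⟩ := Nat.exists_eq_add_of_le' (one_le_two.trans hm)
  rw [Nat.add_sub_cancel, nfold_eq_smulOp hx, Nat.cast_add_one]
end
end

section
/- Distributivity of scalar multiplication: for all x, y ∈ Ω' and real scalars α, β ≥ 0, it holds that α·(x ⊕ y) = (α·x) ⊕ (α·y) and (α+β)·x = (α·x) ⊕ (β·x). -/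
noncomputable section

/-- The opinion with positive evidence `p` and negative evidence `n`, for the scale `c = 1`. -/
def ofEvidence (p n : ℝ) : ℝ × ℝ × ℝ :=
  (p / (p + n + 1), n / (p + n + 1), 1 / (p + n + 1))

theorem eq_ofEvidence {x : ℝ × ℝ × ℝ} (hx : x ∈ Omega') :
    ∃ p n, 0 ≤ p ∧ 0 ≤ n ∧ x = ofEvidence p n := by
  obtain ⟨b, d, u⟩ := x
  obtain ⟨⟨hb, -⟩, ⟨hd, -⟩, ⟨hu, -⟩, h⟩ := hx
  dsimp only at hb hd hu h
  refine ⟨b / u, d / u, by positivity, by positivity, ?_⟩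
  have hs : b / u + d / u + 1 = 1 / u := by
    field_simp
    exact h
  simp only [ofEvidence, hs, Prod.mk.injEq]
  refine ⟨?_, ?_, ?_⟩ <;> field_simp

theorem smulOp_ofEvidence {α p n : ℝ} (hα : 0 ≤ α) (hp : 0 ≤ p) (hn : 0 ≤ n) :
    smulOp α (ofEvidence p n) = ofEvidence (α * p) (α * n) := by
  have hs : 0 < p + n + 1 := by positivity
  have ht : 0 < α * p + α * n + 1 := by positivity
  have hden : α * (p / (p + n + 1) + n / (p + n + 1)) + 1 / (p + n + 1) =
      (α * p + α * n + 1) / (p + n + 1) := by ring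
  simp only [smulOp, ofEvidence, hden, Prod.mk.injEq]
  refine ⟨?_, ?_, ?_⟩ <;> field_simp

theorem consensus_ofEvidence {p n q m : ℝ} (hp : 0 ≤ p) (hn : 0 ≤ n) (hq : 0 ≤ q) (hm : 0 ≤ m) :
    consensus (ofEvidence p n) (ofEvidence q m) = ofEvidence (p + q) (n + m) := by
  have hs : 0 < p + n + 1 := by positivity
  have ht : 0 < q + m + 1 := by positivity
  have hr : 0 < p + q + (n + m) + 1 := by positivity
  have hden : 1 / (p + n + 1) + 1 / (q + m + 1) - 1 / (p + n + 1) * (1 / (q + m + 1)) =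
      (p + q + (n + m) + 1) / ((p + n + 1) * (q + m + 1)) := by
    field_simp
    ring
  simp only [consensus, ofEvidence, hden, Prod.mk.injEq]
  refine ⟨?_, ?_, ?_⟩ <;> field_simp <;> ring

theorem stmt5 (x y : ℝ × ℝ × ℝ) (hx : x ∈ Omega') (hy : y ∈ Omega')
    (α β : ℝ) (hα : 0 ≤ α) (hβ : 0 ≤ β) :
    smulOp α (consensus x y) = consensus (smulOp α x) (smulOp α y) ∧
    smulOp (α + β) x = consensus (smulOp α x) (smulOp β x) := by
  obtain ⟨p, n, hp, hn, rfl⟩ := eq_ofEvidence hx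
  obtain ⟨q, m, hq, hm, rfl⟩ := eq_ofEvidence hy
  constructor
  · rw [consensus_ofEvidence hp hn hq hm,
      smulOp_ofEvidence hα (add_nonneg hp hq) (add_nonneg hn hm),
      smulOp_ofEvidence hα hp hn, smulOp_ofEvidence hα hq hm,
      consensus_ofEvidence (mul_nonneg hα hp) (mul_nonneg hα hn) (mul_nonneg hα hq)
        (mul_nonneg hα hm), mul_add, mul_add]
  · rw [smulOp_ofEvidence (add_nonneg hα hβ) hp hn, smulOp_ofEvidence hα hp hn,
      smulOp_ofEvidence hβ hp hn,
      consensus_ofEvidence (mul_nonneg hα hp) (mul_nonneg hα hn) (mul_nonneg hβ hp)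
        (mul_nonneg hβ hn), add_mul, add_mul]
end
end

section
/- For all x ∈ Ω' and real scalars α, β ≥ 0, it holds that α·(β·x) = (αβ)·x. -/
noncomputable section

/-- The normalizing denominator of `smulOp` is positive on `Omega'`. -/
theorem smulOp_denom_pos {x : ℝ × ℝ × ℝ} (hx : x ∈ Omega') {α : ℝ} (hα : 0 ≤ α) :
    0 < α * (x.1 + x.2.1) + x.2.2 := by
  obtain ⟨⟨hb, -⟩, ⟨hd, -⟩, ⟨hu, -⟩, -⟩ := hx
  positivity

theorem stmt6 (x : ℝ × ℝ × ℝ) (hx : x ∈ Omega') (α β : ℝ) (hα : 0 ≤ α) (hβ : 0 ≤ β) :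
    smulOp α (smulOp β x) = smulOp (α * β) x := by
  have hD := (smulOp_denom_pos hx hβ).ne'
  have key : α * ((smulOp β x).1 + (smulOp β x).2.1) + (smulOp β x).2.2 =
      (α * β * (x.1 + x.2.1) + x.2.2) / (β * (x.1 + x.2.1) + x.2.2) := by
    simp only [smulOp]
    ring
  have hE := (smulOp_denom_pos hx (mul_nonneg hα hβ)).ne'
  rw [smulOp, key]
  simp only [smulOp, Prod.mk.injEq]
  refine ⟨?_, ?_, ?_⟩ <;> field_simp
end
end

section
/- Let g : Ω' → [0,1] be any function and let x, y ∈ Ω'. The new discounting x ⊠ y = g(x)·y satisfies: (1) x ⊠ y ∈ Ω'; (2) p(x ⊠ y) = g(x)·p(y) and n(x ⊠ y) = g(x)·n(y); (3) the belief-to-disbelief ratio of y is preserved: (x ⊠ y)_b · y_d = (x ⊠ y)_d · y_b; (4) x ⊠ U = U. -/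
noncomputable section

theorem smulOp_mem_Omega' {a : ℝ} (ha : 0 ≤ a) {y : ℝ × ℝ × ℝ} (hy : y ∈ Omega') :
    smulOp a y ∈ Omega' := by
  obtain ⟨b, d, u⟩ := y
  obtain ⟨⟨hb, -⟩, ⟨hd, -⟩, ⟨hu, -⟩, -⟩ := hy
  dsimp only at hb hd hu
  have hab := mul_nonneg ha hb
  have had := mul_nonneg ha hd
  have hD : 0 < a * (b + d) + u := by positivity
  refine ⟨⟨?_, ?_⟩, ⟨?_, ?_⟩, ⟨?_, ?_⟩, ?_⟩ <;> dsimp only [smulOp]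
  · positivity
  · rw [div_lt_one hD]; linarith
  · positivity
  · rw [div_lt_one hD]; linarith
  · positivity
  · rw [div_le_one hD]; linarith
  · field_simp

theorem stmt7 (c : ℝ) (hc : 0 < c) (g : ℝ × ℝ × ℝ → ℝ)
    (hg : ∀ x ∈ Omega', g x ∈ Set.Icc (0:ℝ) 1)
    (x y : ℝ × ℝ × ℝ) (hx : x ∈ Omega') (hy : y ∈ Omega') :
    box g x y ∈ Omega' ∧
    pEv c (box g x y) = g x * pEv c y ∧
    nEv c (box g x y) = g x * nEv c y ∧
    (box g x y).1 * y.2.1 = (box g x y).2.1 * y.1 ∧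
    box g x Uop = Uop := by
  have ha : 0 ≤ g x := (hg x hx).1
  refine ⟨smulOp_mem_Omega' ha hy, ?_⟩
  obtain ⟨b, d, u⟩ := y
  obtain ⟨⟨hb, -⟩, ⟨hd, -⟩, ⟨hu, -⟩, -⟩ := hy
  dsimp only at hb hd hu
  have hD : g x * (b + d) + u ≠ 0 := by positivity
  refine ⟨?_, ?_, ?_, ?_⟩
  · simp only [pEv, box, smulOp]
    field_simp
  · simp only [nEv, box, smulOp]
    field_simp
  · simp only [box, smulOp]
    ring
  · simp [box, smulOp, Uop]
end
end

section
/- Discounting cannot decrease uncertainty: for any function g : Ω' → [0,1] and all x, y ∈ Ω', the uncertainty component of the discounted opinion satisfies (x ⊠ y)_u ≥ y_u. -/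
noncomputable section

theorem stmt8 (g : ℝ × ℝ × ℝ → ℝ) (hg : ∀ x ∈ Omega', g x ∈ Set.Icc (0:ℝ) 1)
    (x y : ℝ × ℝ × ℝ) (hx : x ∈ Omega') (hy : y ∈ Omega') :
    (box g x y).2.2 ≥ y.2.2 := by
  obtain ⟨hg0, hg1⟩ := hg x hx
  obtain ⟨⟨hb, -⟩, ⟨hd, -⟩, ⟨hu, -⟩, hsum⟩ := hy
  have hpos : 0 < g x * (y.1 + y.2.1) + y.2.2 := by positivity
  have hle : g x * (y.1 + y.2.1) + y.2.2 ≤ 1 := by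
    linarith [mul_le_of_le_one_left (add_nonneg hb hd) hg1]
  exact le_div_self hu.le hpos hle
end
end

section
/- Let g : Ω' → [0,1] be a function such that g tends to 1 at B within Ω', g tends to 0 at D within Ω', and g(U) = 0. Let x ∈ Ω' with g(x) > 0. Then: (1) y ⊠ x tends to x as y tends to B within Ω'; (2) x ⊠ y tends to B as y tends to B within Ω'; (3) y ⊠ x tends to U as y tends to D within Ω'; (4) x ⊠ y tends to D as y tends to D within Ω'; (5) U ⊠ x = U. -/
noncomputable section

/-- Full belief B = (1,0,0). -/
def Bop : ℝ × ℝ × ℝ := (1, 0, 0)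

/-- Full disbelief D = (0,1,0). -/
def Dop : ℝ × ℝ × ℝ := (0, 1, 0)

theorem continuousAt_smulOp {α : ℝ} {x : ℝ × ℝ × ℝ} (h : α * (x.1 + x.2.1) + x.2.2 ≠ 0) :
    ContinuousAt (fun p : ℝ × ℝ × ℝ × ℝ => smulOp p.1 p.2) (α, x) := by
  unfold smulOp
  refine ContinuousAt.prodMk ?_ (ContinuousAt.prodMk ?_ ?_) <;>
    exact ContinuousAt.div (by fun_prop) (by fun_prop) h

theorem Filter.Tendsto.smulOp {ι : Type*} {l : Filter ι} {a : ι → ℝ} {f : ι → ℝ × ℝ × ℝ} {α : ℝ}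
    {x : ℝ × ℝ × ℝ} (ha : Tendsto a l (nhds α)) (hf : Tendsto f l (nhds x))
    (h : α * (x.1 + x.2.1) + x.2.2 ≠ 0) :
    Tendsto (fun i => smulOp (a i) (f i)) l (nhds (_root_.smulOp α x)) :=
  (continuousAt_smulOp h).tendsto.comp (ha.prodMk_nhds hf)

theorem smulOp_one_s9 {x : ℝ × ℝ × ℝ} (h : x.1 + x.2.1 + x.2.2 = 1) : smulOp 1 x = x := by
  simp [smulOp, h]

theorem smulOp_zero {x : ℝ × ℝ × ℝ} (h : x.2.2 ≠ 0) : smulOp 0 x = Uop := by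
  simp [smulOp, Uop, h]

theorem smulOp_Bop {α : ℝ} (h : α ≠ 0) : smulOp α Bop = Bop := by
  simp [smulOp, Bop, h]

theorem smulOp_Dop {α : ℝ} (h : α ≠ 0) : smulOp α Dop = Dop := by
  simp [smulOp, Dop, h]

theorem stmt9 (g : ℝ × ℝ × ℝ → ℝ) (hg : ∀ x ∈ Omega', g x ∈ Set.Icc (0:ℝ) 1)
    (hgB : Filter.Tendsto g (nhdsWithin Bop Omega') (nhds 1))
    (hgD : Filter.Tendsto g (nhdsWithin Dop Omega') (nhds 0))
    (hgU : g Uop = 0)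
    (x : ℝ × ℝ × ℝ) (hx : x ∈ Omega') (hgx : 0 < g x) :
    Filter.Tendsto (fun y => box g y x) (nhdsWithin Bop Omega') (nhds x) ∧
    Filter.Tendsto (fun y => box g x y) (nhdsWithin Bop Omega') (nhds Bop) ∧
    Filter.Tendsto (fun y => box g y x) (nhdsWithin Dop Omega') (nhds Uop) ∧
    Filter.Tendsto (fun y => box g x y) (nhdsWithin Dop Omega') (nhds Dop) ∧
    box g Uop x = Uop := by
  obtain ⟨-, -, hu, hsum⟩ := hx
  have hu0 : x.2.2 ≠ 0 := hu.1.ne'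
  have tendsto_id (z : ℝ × ℝ × ℝ) : Filter.Tendsto (fun y => y) (nhdsWithin z Omega') (nhds z) :=
    nhdsWithin_le_nhds
  unfold box
  refine ⟨?_, ?_, ?_, ?_, ?_⟩
  · simpa only [smulOp_one_s9 hsum] using
      hgB.smulOp (tendsto_const_nhds (x := x)) (by simp [hsum])
  · simpa only [smulOp_Bop hgx.ne'] using
      (tendsto_const_nhds (x := g x)).smulOp (tendsto_id Bop) (by simp [Bop, hgx.ne'])
  · simpa only [smulOp_zero hu0] using
      hgD.smulOp (tendsto_const_nhds (x := x)) (by simp [hu0])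
  · simpa only [smulOp_Dop hgx.ne'] using
      (tendsto_const_nhds (x := g x)).smulOp (tendsto_id Dop) (by simp [Dop, hgx.ne'])
  · rw [hgU, smulOp_zero hu0]
end
end

section
/- There is no function g : Ω' → [0,1] such that g(x)·y = x ⊗ y for all x, y ∈ Ω'. Equivalently, for every function g : Ω' → [0,1] there exist x, y ∈ Ω' with g(x)·y ≠ x ⊗ y. -/
noncomputable section

theorem stmt10 (g : ℝ × ℝ × ℝ → ℝ) (hg : ∀ x ∈ Omega', g x ∈ Set.Icc (0:ℝ) 1) :
    ∃ x ∈ Omega', ∃ y ∈ Omega', smulOp (g x) y ≠ otimesSL x y := by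
  by_contra! h
  have hx : ((1 / 2, 0, 1 / 2) : ℝ × ℝ × ℝ) ∈ Omega' := by norm_num [Omega']
  have hy : ((1 / 4, 0, 3 / 4) : ℝ × ℝ × ℝ) ∈ Omega' := by norm_num [Omega']
  have hα := (hg _ hx).1
  have h₁ := congrArg Prod.fst (h _ hx _ hx)
  have h₂ := congrArg Prod.fst (h _ hx _ hy)
  simp only [smulOp, otimesSL] at h₁ h₂
  rw [div_eq_iff (by positivity)] at h₁ h₂
  linarith
end
end

section
/- Right-distributivity of the new discounting over consensus: for any function g : Ω' → [0,1] and all x, y, z ∈ Ω', it holds that x ⊠ (y ⊕ z) = (x ⊠ y) ⊕ (x ⊠ z). -/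
noncomputable section

/-- Scalar multiplication of a consensus, with the normalisation of the consensus cancelled. -/
theorem smulOp_consensus (α : ℝ) (y z : ℝ × ℝ × ℝ)
    (h : y.2.2 + z.2.2 - y.2.2 * z.2.2 ≠ 0) :
    smulOp α (consensus y z) =
      (α * (y.2.2 * z.1 + z.2.2 * y.1) /
        (α * (y.2.2 * (z.1 + z.2.1) + z.2.2 * (y.1 + y.2.1)) + y.2.2 * z.2.2),
       α * (y.2.2 * z.2.1 + z.2.2 * y.2.1) /
        (α * (y.2.2 * (z.1 + z.2.1) + z.2.2 * (y.1 + y.2.1)) + y.2.2 * z.2.2),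
       y.2.2 * z.2.2 /
        (α * (y.2.2 * (z.1 + z.2.1) + z.2.2 * (y.1 + y.2.1)) + y.2.2 * z.2.2)) := by
  obtain ⟨a, b, u⟩ := y
  obtain ⟨c, d, v⟩ := z
  simp only [smulOp, consensus] at h ⊢
  have hE : α * ((u * c + v * a) / (u + v - u * v) + (u * d + v * b) / (u + v - u * v)) +
      u * v / (u + v - u * v) =
      (α * (u * (c + d) + v * (a + b)) + u * v) / (u + v - u * v) := by ring
  rw [hE, ← mul_div_assoc, ← mul_div_assoc, div_div_div_cancel_right₀ h,
    div_div_div_cancel_right₀ h, div_div_div_cancel_right₀ h]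

/-- Consensus of scalar multiples, with the normalisations of the multiples cancelled. -/
theorem consensus_smulOp_s11 (α : ℝ) (y z : ℝ × ℝ × ℝ)
    (hy : α * (y.1 + y.2.1) + y.2.2 ≠ 0) (hz : α * (z.1 + z.2.1) + z.2.2 ≠ 0) :
    consensus (smulOp α y) (smulOp α z) =
      (α * (y.2.2 * z.1 + z.2.2 * y.1) /
        (α * (y.2.2 * (z.1 + z.2.1) + z.2.2 * (y.1 + y.2.1)) + y.2.2 * z.2.2),
       α * (y.2.2 * z.2.1 + z.2.2 * y.2.1) /
        (α * (y.2.2 * (z.1 + z.2.1) + z.2.2 * (y.1 + y.2.1)) + y.2.2 * z.2.2),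
       y.2.2 * z.2.2 /
        (α * (y.2.2 * (z.1 + z.2.1) + z.2.2 * (y.1 + y.2.1)) + y.2.2 * z.2.2)) := by
  obtain ⟨a, b, u⟩ := y
  obtain ⟨c, d, v⟩ := z
  simp only [smulOp, consensus] at hy hz ⊢
  set A := α * (a + b) + u with hA
  set B := α * (c + d) + v with hB
  have hAB : A * B ≠ 0 := mul_ne_zero hy hz
  have hE : u / A + v / B - u / A * (v / B) =
      (α * (u * (c + d) + v * (a + b)) + u * v) / (A * B) := by
    have : α * (u * (c + d) + v * (a + b)) + u * v = u * B + v * A - u * v := by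
      linear_combination -u * hB - v * hA
    rw [this]
    field_simp
  have hnum (p q : ℝ) :
      u / A * (α * q / B) + v / B * (α * p / A) = α * (u * q + v * p) / (A * B) := by
    rw [div_mul_div_comm, div_mul_div_comm, mul_comm B A, ← add_div]
    congr 1
    ring
  rw [hE, hnum, hnum, div_mul_div_comm, div_div_div_cancel_right₀ hAB,
    div_div_div_cancel_right₀ hAB, div_div_div_cancel_right₀ hAB]

theorem smulOp_denom_pos_s11 {α : ℝ} (hα : 0 ≤ α) {y : ℝ × ℝ × ℝ} (hy : y ∈ Omega') :
    0 < α * (y.1 + y.2.1) + y.2.2 := by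
  obtain ⟨hb, hd, hu, -⟩ := hy
  exact add_pos_of_nonneg_of_pos (mul_nonneg hα (add_nonneg hb.1 hd.1)) hu.1

theorem consensus_denom_pos_s11 {y z : ℝ × ℝ × ℝ} (hy : y ∈ Omega') (hz : z ∈ Omega') :
    0 < y.2.2 + z.2.2 - y.2.2 * z.2.2 := by
  obtain ⟨-, -, hu, -⟩ := hy
  obtain ⟨-, -, hv, -⟩ := hz
  nlinarith [hu.1, mul_nonneg hv.1.le (sub_nonneg.2 hu.2)]

theorem stmt11 (g : ℝ × ℝ × ℝ → ℝ) (hg : ∀ x ∈ Omega', g x ∈ Set.Icc (0:ℝ) 1)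
    (x y z : ℝ × ℝ × ℝ) (hx : x ∈ Omega') (hy : y ∈ Omega') (hz : z ∈ Omega') :
    box g x (consensus y z) = consensus (box g x y) (box g x z) := by
  have hα := (hg x hx).1
  exact (smulOp_consensus _ y z (consensus_denom_pos_s11 hy hz).ne').trans
    (consensus_smulOp_s11 _ y z (smulOp_denom_pos_s11 hα hy).ne' (smulOp_denom_pos_s11 hα hz).ne').symm
end
end

section
/- Chain of discountings: for any function g : Ω' → [0,1], any finite list x₁, …, x_N of opinions in Ω' and any y ∈ Ω', the nested discounting x₁ ⊠ (x₂ ⊠ (⋯ (x_N ⊠ y))) equals (∏_{i=1}^N g(x_i))·y. In particular, the result is invariant under any permutation of the opinions x₁, …, x_N. -/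
noncomputable section

theorem smulOp_one_s13 {y : ℝ × ℝ × ℝ} (hy : y.1 + y.2.1 + y.2.2 = 1) : smulOp 1 y = y := by
  simp [smulOp, hy]

theorem smulOp_smulOp (a : ℝ) {b : ℝ} {y : ℝ × ℝ × ℝ} (h : b * (y.1 + y.2.1) + y.2.2 ≠ 0) :
    smulOp a (smulOp b y) = smulOp (a * b) y := by
  have key : a * (b * y.1 / (b * (y.1 + y.2.1) + y.2.2) +
      b * y.2.1 / (b * (y.1 + y.2.1) + y.2.2)) + y.2.2 / (b * (y.1 + y.2.1) + y.2.2) =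
      (a * b * (y.1 + y.2.1) + y.2.2) / (b * (y.1 + y.2.1) + y.2.2) := by
    ring
  simp only [smulOp, key, ← mul_div_assoc, ← mul_assoc, div_div_div_cancel_right₀ h]

theorem foldr_box_eq_smulOp_prod {g : ℝ × ℝ × ℝ → ℝ} {l : List (ℝ × ℝ × ℝ)}
    (hl : ∀ x ∈ l, 0 ≤ g x) {y : ℝ × ℝ × ℝ} (hy : y ∈ Omega') :
    l.foldr (box g) y = smulOp (l.map g).prod y := by
  obtain ⟨hb, hd, hu, hsum⟩ := hy
  induction l with
  | nil => exact (smulOp_one_s13 hsum).symm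
  | cons x l ih =>
    rw [List.forall_mem_cons] at hl
    have hprod : 0 ≤ (l.map g).prod := List.prod_nonneg (List.forall_mem_map.mpr hl.2)
    rw [List.foldr_cons, ih hl.2, List.map_cons, List.prod_cons, box, smulOp_smulOp]
    exact (add_pos_of_nonneg_of_pos (mul_nonneg hprod (add_nonneg hb.1 hd.1)) hu.1).ne'

theorem stmt13 (g : ℝ × ℝ × ℝ → ℝ) (hg : ∀ x ∈ Omega', g x ∈ Set.Icc (0:ℝ) 1)
    (l : List (ℝ × ℝ × ℝ)) (hl : ∀ x ∈ l, x ∈ Omega')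
    (y : ℝ × ℝ × ℝ) (hy : y ∈ Omega') :
    l.foldr (box g) y = smulOp (l.map g).prod y ∧
    (∀ l' : List (ℝ × ℝ × ℝ), l.Perm l' → l.foldr (box g) y = l'.foldr (box g) y) := by
  have hnonneg : ∀ x ∈ l, 0 ≤ g x := fun x hx => (hg x (hl x hx)).1
  refine ⟨foldr_box_eq_smulOp_prod hnonneg hy, fun l' h => ?_⟩
  rw [foldr_box_eq_smulOp_prod hnonneg hy,
    foldr_box_eq_smulOp_prod (fun x hx => hnonneg x (h.mem_iff.mpr hx)) hy, (h.map g).prod_eq]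
end
end

section
/- Left-distributivity of the ⊙ discounting: fix c > 0 and θ > 0 and define x ⊙ y = (p(x)/θ)·y. Then for all x, y, z ∈ Ω', it holds that (x ⊕ y) ⊙ z = (x ⊙ z) ⊕ (y ⊙ z). -/
noncomputable section

/-- The specific discounting rule x ⊙ y = (p(x)/θ)·y. -/
def odot (c θ : ℝ) (x y : ℝ × ℝ × ℝ) : ℝ × ℝ × ℝ := smulOp (pEv c x / θ) y

lemma consensus_denom_pos_s15 {a b : ℝ} (ha : a ∈ Set.Ioc (0:ℝ) 1) (hb : 0 < b) :
    0 < a + b - a * b := by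
  nlinarith [mul_le_mul_of_nonneg_right ha.2 hb.le, ha.1]

/-- Consensus adds up positive evidence. -/
lemma pEv_consensus (c : ℝ) {x y : ℝ × ℝ × ℝ} (hx : x.2.2 ∈ Set.Ioc (0:ℝ) 1)
    (hy : 0 < y.2.2) : pEv c (consensus x y) = pEv c x + pEv c y := by
  have hD := (consensus_denom_pos_s15 hx hy).ne'
  have hx0 := hx.1.ne'
  have hy0 := hy.ne'
  simp only [pEv, consensus]
  rw [← mul_div_assoc, div_div_div_cancel_right₀ hD]
  field_simp
  ring

/-- Scalar multiplication distributes over the addition of nonnegative scalars. -/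
lemma smulOp_add {α β : ℝ} (hα : 0 ≤ α) (hβ : 0 ≤ β) {z : ℝ × ℝ × ℝ}
    (hb : 0 ≤ z.1) (hd : 0 ≤ z.2.1) (hu : 0 < z.2.2) :
    smulOp (α + β) z = consensus (smulOp α z) (smulOp β z) := by
  obtain ⟨b, d, u⟩ := z
  simp only at hb hd hu
  have hA : α * (b + d) + u ≠ 0 := by positivity
  have hB : β * (b + d) + u ≠ 0 := by positivity
  have hC : (α + β) * (b + d) + u ≠ 0 := by positivity
  have hu0 := hu.ne'
  have hD : u / (α * (b + d) + u) + u / (β * (b + d) + u)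
      - u / (α * (b + d) + u) * (u / (β * (b + d) + u))
      = u * ((α + β) * (b + d) + u) / ((α * (b + d) + u) * (β * (b + d) + u)) := by
    field_simp
    ring
  simp only [smulOp, consensus, hD, Prod.mk.injEq]
  refine ⟨?_, ?_, ?_⟩ <;> field_simp
  all_goals ring

lemma pEv_nonneg {c : ℝ} (hc : 0 ≤ c) {x : ℝ × ℝ × ℝ} (hb : 0 ≤ x.1) (hu : 0 ≤ x.2.2) :
    0 ≤ pEv c x :=
  div_nonneg (mul_nonneg hc hb) hu

theorem stmt15 (c θ : ℝ) (hc : 0 < c) (hθ : 0 < θ)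
    (x y z : ℝ × ℝ × ℝ) (hx : x ∈ Omega') (hy : y ∈ Omega') (hz : z ∈ Omega') :
    odot c θ (consensus x y) z = consensus (odot c θ x z) (odot c θ y z) := by
  obtain ⟨hxb, -, hxu, -⟩ := hx
  obtain ⟨hyb, -, hyu, -⟩ := hy
  obtain ⟨hzb, hzd, hzu, -⟩ := hz
  simp only [odot]
  rw [pEv_consensus c hxu hyu.1, add_div]
  exact smulOp_add (div_nonneg (pEv_nonneg hc.le hxb.1 hxu.1.le) hθ.le)
    (div_nonneg (pEv_nonneg hc.le hyb.1 hyu.1.le) hθ.le) hzb.1 hzd.1 hzu.1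
end
end

section
/- Linearity of additive discount functions: fix c > 0 and let g : Ω' → ℝ be a nonnegative function satisfying g(x ⊕ y) = g(x) + g(y) for all x, y ∈ Ω'. Then there exist real constants α, β ≥ 0 such that g(x) = α·p(x) + β·n(x) for all x ∈ Ω'. -/
noncomputable section

/-- A nonnegative additive function on the nonnegative reals is linear there. -/
theorem eq_mul_of_additive_of_nonneg {f : ℝ → ℝ} (hf : ∀ x, 0 ≤ x → 0 ≤ f x)
    (hadd : ∀ x y, 0 ≤ x → 0 ≤ y → f (x + y) = f x + f y) {x : ℝ} (hx : 0 ≤ x) :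
    f x = f 1 * x := by
  have hzero : f 0 = 0 := by
    have h := hadd 0 0 le_rfl le_rfl
    rw [add_zero] at h
    linarith
  have hnat : ∀ (n : ℕ) (y : ℝ), 0 ≤ y → f (n * y) = n * f y := by
    intro n y hy
    induction n with
    | zero => simp [hzero]
    | succ k ih =>
      rw [Nat.cast_succ, add_mul, one_mul, hadd _ _ (by positivity) hy, ih]
      ring
  have hmono : ∀ a b, 0 ≤ a → a ≤ b → f a ≤ f b := by
    intro a b ha hab
    have h := hadd a (b - a) ha (sub_nonneg.2 hab)
    rw [add_sub_cancel] at h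
    linarith [hf (b - a) (sub_nonneg.2 hab)]
  have hone : 0 ≤ f 1 := hf 1 zero_le_one
  have hbound : ∀ n : ℕ, n * |f x - f 1 * x| ≤ f 1 := by
    intro n
    have hnx : 0 ≤ (n : ℝ) * x := by positivity
    have hle := Nat.floor_le hnx
    have hlt := Nat.lt_floor_add_one ((n : ℝ) * x)
    set m := ⌊(n : ℝ) * x⌋₊
    have hlow := hmono m (n * x) (by positivity) hle
    have hupp := hmono (n * x) (m + 1) hnx hlt.le
    have hm := hnat m 1 zero_le_one
    rw [mul_one] at hm
    rw [hadd m 1 (by positivity) zero_le_one, hm, hnat n x hx] at hupp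
    rw [hm, hnat n x hx] at hlow
    have habs : (n : ℝ) * |f x - f 1 * x| = |n * (f x - f 1 * x)| := by
      rw [abs_mul, Nat.abs_cast]
    rw [habs, abs_le]
    constructor <;> nlinarith [mul_le_mul_of_nonneg_right hle hone,
      mul_le_mul_of_nonneg_right hlt.le hone]
  by_contra hne
  have hpos : 0 < |f x - f 1 * x| := abs_pos.2 (sub_ne_zero.2 hne)
  obtain ⟨n, hn⟩ := exists_nat_gt (f 1 / |f x - f 1 * x|)
  rw [div_lt_iff₀ hpos] at hn
  linarith [hbound n]

/-- The opinion whose belief-to-uncertainty and disbelief-to-uncertainty ratios are `r` and `s`. -/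
def opinionOfEvidence (r s : ℝ) : ℝ × ℝ × ℝ :=
  (r / (r + s + 1), s / (r + s + 1), 1 / (r + s + 1))

theorem opinionOfEvidence_mem {r s : ℝ} (hr : 0 ≤ r) (hs : 0 ≤ s) :
    opinionOfEvidence r s ∈ Omega' := by
  have ht : 0 < r + s + 1 := by positivity
  refine ⟨⟨div_nonneg hr ht.le, ?_⟩, ⟨div_nonneg hs ht.le, ?_⟩, ⟨one_div_pos.2 ht, ?_⟩, ?_⟩
  · exact (div_lt_one ht).2 (by linarith)
  · exact (div_lt_one ht).2 (by linarith)
  · exact (div_le_one ht).2 (by linarith)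
  · simp only [opinionOfEvidence]
    field_simp

theorem consensus_opinionOfEvidence {r s r' s' : ℝ} (hr : 0 ≤ r) (hs : 0 ≤ s) (hr' : 0 ≤ r')
    (hs' : 0 ≤ s') :
    consensus (opinionOfEvidence r s) (opinionOfEvidence r' s') =
      opinionOfEvidence (r + r') (s + s') := by
  have ht : r + s + 1 ≠ 0 := by positivity
  have ht' : r' + s' + 1 ≠ 0 := by positivity
  have hsum : r + r' + (s + s') + 1 ≠ 0 := by positivity
  have hden : 1 / (r + s + 1) + 1 / (r' + s' + 1) - 1 / (r + s + 1) * (1 / (r' + s' + 1)) =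
      (r + r' + (s + s') + 1) / ((r + s + 1) * (r' + s' + 1)) := by
    field_simp
    ring
  simp only [consensus, opinionOfEvidence, hden, Prod.mk.injEq]
  refine ⟨?_, ?_, ?_⟩
  · field_simp
    ring
  · field_simp
    ring
  · field_simp

theorem opinionOfEvidence_div {x : ℝ × ℝ × ℝ} (hx : x ∈ Omega') :
    opinionOfEvidence (x.1 / x.2.2) (x.2.1 / x.2.2) = x := by
  obtain ⟨-, -, ⟨hu, -⟩, hsum⟩ := hx
  have hden : x.1 / x.2.2 + x.2.1 / x.2.2 + 1 = 1 / x.2.2 := by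
    field_simp
    exact hsum
  have hne := hu.ne'
  simp only [opinionOfEvidence, hden]
  ext <;> simp [hne]

theorem stmt17 (c : ℝ) (hc : 0 < c) (g : ℝ × ℝ × ℝ → ℝ)
    (hg0 : ∀ x ∈ Omega', 0 ≤ g x)
    (hadd : ∀ x ∈ Omega', ∀ y ∈ Omega', g (consensus x y) = g x + g y) :
    ∃ α β : ℝ, 0 ≤ α ∧ 0 ≤ β ∧ ∀ x ∈ Omega', g x = α * pEv c x + β * nEv c x := by
  have hG : ∀ r s r' s' : ℝ, 0 ≤ r → 0 ≤ s → 0 ≤ r' → 0 ≤ s' →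
      g (opinionOfEvidence (r + r') (s + s')) =
        g (opinionOfEvidence r s) + g (opinionOfEvidence r' s') := by
    intro r s r' s' hr hs hr' hs'
    rw [← consensus_opinionOfEvidence hr hs hr' hs']
    exact hadd _ (opinionOfEvidence_mem hr hs) _ (opinionOfEvidence_mem hr' hs')
  have hp {r : ℝ} (hr : 0 ≤ r) :
      g (opinionOfEvidence r 0) = g (opinionOfEvidence 1 0) * r :=
    eq_mul_of_additive_of_nonneg (f := fun r => g (opinionOfEvidence r 0))
      (fun _ h => hg0 _ (opinionOfEvidence_mem h le_rfl))
      (fun a b ha hb => by simpa using hG a 0 b 0 ha le_rfl hb le_rfl) hr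
  have hn {s : ℝ} (hs : 0 ≤ s) :
      g (opinionOfEvidence 0 s) = g (opinionOfEvidence 0 1) * s :=
    eq_mul_of_additive_of_nonneg (f := fun s => g (opinionOfEvidence 0 s))
      (fun _ h => hg0 _ (opinionOfEvidence_mem le_rfl h))
      (fun a b ha hb => by simpa using hG 0 a 0 b le_rfl ha le_rfl hb) hs
  refine ⟨g (opinionOfEvidence 1 0) / c, g (opinionOfEvidence 0 1) / c,
    div_nonneg (hg0 _ (opinionOfEvidence_mem zero_le_one le_rfl)) hc.le,
    div_nonneg (hg0 _ (opinionOfEvidence_mem le_rfl zero_le_one)) hc.le, fun x hx => ?_⟩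
  have hr : 0 ≤ x.1 / x.2.2 := div_nonneg hx.1.1 hx.2.2.1.1.le
  have hs : 0 ≤ x.2.1 / x.2.2 := div_nonneg hx.2.1.1 hx.2.2.1.1.le
  have hsplit := hG (x.1 / x.2.2) 0 0 (x.2.1 / x.2.2) hr le_rfl le_rfl hs
  rw [add_zero, zero_add, opinionOfEvidence_div hx, hp hr, hn hs] at hsplit
  rw [hsplit, pEv, nEv]
  field_simp
end
end

section
/- Non-associativity formulas for the new discounting: for any function g : Ω' → [0,1] and all x, y, z ∈ Ω', it holds that x ⊠ (y ⊠ z) = (g(x)·g(y))·z, whereas (x ⊠ y) ⊠ z = g(g(x)·y)·z. -/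
noncomputable section

theorem smulOp_smulOp_s19 {α β : ℝ} (hβ : 0 ≤ β) {z : ℝ × ℝ × ℝ} (hz : z ∈ Omega') :
    smulOp α (smulOp β z) = smulOp (α * β) z := by
  obtain ⟨⟨hb, -⟩, ⟨hd, -⟩, ⟨hu, -⟩, -⟩ := hz
  have hden : β * (z.1 + z.2.1) + z.2.2 ≠ 0 := by positivity
  have hscale : α * (β * z.1 / (β * (z.1 + z.2.1) + z.2.2) +
      β * z.2.1 / (β * (z.1 + z.2.1) + z.2.2)) + z.2.2 / (β * (z.1 + z.2.1) + z.2.2) =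
      (α * β * (z.1 + z.2.1) + z.2.2) / (β * (z.1 + z.2.1) + z.2.2) := by ring
  simp only [smulOp, hscale, ← mul_div_assoc, ← mul_assoc, div_div_div_cancel_right₀ hden]

theorem stmt19 (g : ℝ × ℝ × ℝ → ℝ) (hg : ∀ x ∈ Omega', g x ∈ Set.Icc (0:ℝ) 1)
    (x y z : ℝ × ℝ × ℝ) (hx : x ∈ Omega') (hy : y ∈ Omega') (hz : z ∈ Omega') :
    box g x (box g y z) = smulOp (g x * g y) z ∧
    box g (box g x y) z = smulOp (g (smulOp (g x) y)) z := by
  exact ⟨smulOp_smulOp_s19 (hg y hy).1 hz, rfl⟩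
end
end
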